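/- arXiv:math/0402141 — 2 statements merged into one kernel-verified Lean document; each statement's English description precedes it below -/
import Mathlib

section
/- Let e₀, e₁, …, eₙ be the standard basis of ℤ^{n+1}, and let S ⊆ ℤ^{n+1} be the subgroup generated by the elements bᵢ·e₀ + aᵢ·eᵢ for i = 1, …, n together with the elements β(η)·e₀ − Σᵢ₌₁ⁿ δᵢ(η)·eᵢ for all η ∈ N. Then the quotient group ℤ^{n+1}/S is trivial. -/
/-- Orlik–Wagreich presentation: under the hypotheses of the paper's Proposition 4
(the `[Dᵢ]` form part of a basis of `H₂(X,ℤ)` and `a·c₁(L)` is not divisible), the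
abelian group presented by generators `k, g₁, …, gₙ` and relations `aᵢgᵢ + bᵢk = 0`
and `β(η)k − Σᵢ δᵢ(η)gᵢ = 0` is trivial; i.e. the subgroup `S ⊆ ℤ^{n+1}` generated by
the relation vectors is all of `ℤ^{n+1}`. -/
theorem relation_subgroup_is_top
    (n : ℕ) (hn : 1 ≤ n) (a b : Fin n → ℕ)
    (ha : ∀ i, 0 < a i) (hb : ∀ i, 0 < b i)
    (hab : ∀ i, Nat.Coprime (a i) (b i))
    (N : Type) [AddCommGroup N] [Module.Free ℤ N] [Module.Finite ℤ N]
    (β : N →+ ℤ) (δ : Fin n → N →+ ℤ)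
    -- (i) the `δᵢ` are part of a dual basis: there are `ηⱼ` with `δᵢ(ηⱼ) = δᵢⱼ`
    (hbasis : ∃ η : Fin n → N, ∀ i j, δ i (η j) = if i = j then 1 else 0)
    -- (ii) `a·c₁(L)` is not divisible: for each prime `p` some value is not divisible by `p`
    (hnondiv : ∀ p : ℕ, p.Prime → ∃ η : N,
      ¬ ((p : ℤ) ∣ (((Finset.univ.lcm a : ℕ) : ℤ) * β η
          + ∑ i, (b i : ℤ) * ((Finset.univ.lcm a / a i : ℕ) : ℤ) * δ i η))) :
    AddSubgroup.closure
      ((Set.range fun i : Fin n =>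
          (b i : ℤ) • Pi.single (0 : Fin (n + 1)) (1 : ℤ)
            + (a i : ℤ) • Pi.single i.succ (1 : ℤ)) ∪
       (Set.range fun η : N =>
          β η • Pi.single (0 : Fin (n + 1)) (1 : ℤ)
            - ∑ i, δ i η • Pi.single i.succ (1 : ℤ)))
      = (⊤ : AddSubgroup (Fin (n + 1) → ℤ)) := by
  obtain ⟨h, hh⟩ := hbasis
  generalize hS : AddSubgroup.closure (G := Fin (n + 1) → ℤ) _ = S
  have h1 : ∀ i : Fin n, (b i : ℤ) • (Pi.single (0 : Fin (n + 1)) (1 : ℤ) : Fin (n + 1) → ℤ)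
            + (a i : ℤ) • Pi.single i.succ (1 : ℤ) ∈ S := fun i =>
    hS ▸ AddSubgroup.subset_closure (Or.inl ⟨i, rfl⟩)
  have h2 : ∀ η : N, β η • (Pi.single (0 : Fin (n + 1)) (1 : ℤ) : Fin (n + 1) → ℤ)
            - ∑ i, δ i η • (Pi.single i.succ (1 : ℤ) : Fin (n + 1) → ℤ) ∈ S := fun η =>
    hS ▸ AddSubgroup.subset_closure (Or.inr ⟨η, rfl⟩)
  set e : Fin (n + 1) → ℤ := Pi.single (0 : Fin (n + 1)) (1 : ℤ) with he
  have h3 : ∀ j : Fin n, β (h j) • e - Pi.single j.succ (1 : ℤ) ∈ S := by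
    intro j
    have := h2 (h j)
    simpa only [hh, ite_smul, one_smul, zero_smul, Finset.sum_ite_eq', Finset.mem_univ,
      if_true] using this
  have h4 : ∀ i : Fin n, ((b i : ℤ) + a i * β (h i)) • e ∈ S := by
    intro i
    have := S.add_mem (h1 i) (S.zsmul_mem (h3 i) (a i))
    convert this using 1
    module
  have h5 : ∀ η : N, (β η - ∑ i, δ i η * β (h i)) • e ∈ S := by
    intro η
    have := S.sub_mem (h2 η) (S.sum_mem (t := Finset.univ)
      (fun i _ => S.zsmul_mem (h3 i) (δ i η)))
    convert this using 1
    simp only [smul_sub, Finset.sum_sub_distrib, sub_smul, Finset.sum_smul, mul_smul]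
    abel
  have key : e ∈ S := by
    obtain ⟨d, hd⟩ := Int.subgroup_cyclic (S.comap (zmultiplesHom _ e))
    have hmem : ∀ m : ℤ, m • e ∈ S ↔ d ∣ m := by
      intro m
      have : m ∈ S.comap (zmultiplesHom _ e) ↔ m ∈ AddSubgroup.closure {d} := by rw [hd]
      rw [← AddSubgroup.zmultiples_eq_closure, Int.mem_zmultiples_iff] at this
      simpa using this
    by_cases hd1 : d.natAbs = 1
    · have := (hmem 1).2 (Int.natAbs_dvd.1 (by simp [hd1]))
      simpa using this
    · exfalso
      obtain ⟨p, hp, hpd⟩ := Nat.exists_prime_and_dvd hd1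
      have hpd' : (p : ℤ) ∣ d := Int.natCast_dvd.2 hpd
      obtain ⟨η, hη⟩ := hnondiv p hp
      apply hη
      have e1 : (((Finset.univ.lcm a : ℕ) : ℤ) * β η
          + ∑ i, (b i : ℤ) * ((Finset.univ.lcm a / a i : ℕ) : ℤ) * δ i η)
          = ((Finset.univ.lcm a : ℕ) : ℤ) * (β η - ∑ i, δ i η * β (h i))
          + ∑ i, (((Finset.univ.lcm a / a i : ℕ) : ℤ) * δ i η) * ((b i : ℤ) + a i * β (h i)) := by
        rw [mul_sub, sub_add, Finset.mul_sum, ← Finset.sum_sub_distrib, sub_eq_add_neg,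
          ← Finset.sum_neg_distrib]
        congr 1
        refine Finset.sum_congr rfl fun i _ => ?_
        have : ((Finset.univ.lcm a : ℕ) : ℤ) = ((Finset.univ.lcm a / a i : ℕ) : ℤ) * a i := by
          exact_mod_cast (Nat.div_mul_cancel (Finset.dvd_lcm (Finset.mem_univ i))).symm
        generalize ((Finset.univ.lcm a / a i : ℕ) : ℤ) = q at *
        rw [this]
        ring
      rw [e1]
      refine dvd_add (Dvd.dvd.mul_left (hpd'.trans ((hmem _).1 (h5 η))) _)
        (Finset.dvd_sum fun i _ => Dvd.dvd.mul_left (hpd'.trans ((hmem _).1 (h4 i))) _)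
  have hs : ∀ j : Fin n, (Pi.single j.succ (1 : ℤ) : Fin (n + 1) → ℤ) ∈ S := by
    intro j
    have := S.sub_mem (S.zsmul_mem key (β (h j))) (h3 j)
    simpa using this
  rw [eq_top_iff]
  intro x _
  rw [pi_eq_sum_univ' x]
  refine S.sum_mem fun i _ => S.zsmul_mem ?_ _
  have hi : (Pi.single i (1 : ℤ) : Fin (n + 1) → ℤ) ∈ S := by
    refine Fin.cases key hs i
  convert hi using 1
end

section
/- Let p be a prime. Suppose k, g₁, …, gₙ ∈ ℤ/pℤ satisfy aᵢ·gᵢ + bᵢ·k = 0 for every i = 1, …, n and β(η)·k − Σᵢ₌₁ⁿ δᵢ(η)·gᵢ = 0 for every η ∈ N (all equations read modulo p). Then k = 0 and gᵢ = 0 for all i. -/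
/-- The mod-`p` computation in the proof that `H₁(L,ℤ) = 0`: if `k, g₁, …, gₙ ∈ ℤ/p`
satisfy `aᵢgᵢ + bᵢk = 0` for all `i` and `β(η)k − Σᵢ δᵢ(η)gᵢ = 0` for all `η ∈ N`,
then `k = 0` and all `gᵢ = 0`. -/
theorem mod_p_solution_is_trivial
    (n : ℕ) (hn : 1 ≤ n) (a b : Fin n → ℕ)
    (ha : ∀ i, 0 < a i) (hb : ∀ i, 0 < b i)
    (hab : ∀ i, Nat.Coprime (a i) (b i))
    (N : Type) [AddCommGroup N] [Module.Free ℤ N] [Module.Finite ℤ N]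
    (β : N →+ ℤ) (δ : Fin n → N →+ ℤ)
    (hbasis : ∃ η : Fin n → N, ∀ i j, δ i (η j) = if i = j then 1 else 0)
    (p : ℕ) (hp : p.Prime)
    (hnondiv : ∃ η : N,
      ¬ ((p : ℤ) ∣ (((Finset.univ.lcm a : ℕ) : ℤ) * β η
          + ∑ i, (b i : ℤ) * ((Finset.univ.lcm a / a i : ℕ) : ℤ) * δ i η)))
    (k : ZMod p) (g : Fin n → ZMod p)
    (h1 : ∀ i, (a i : ZMod p) * g i + (b i : ZMod p) * k = 0)
    (h2 : ∀ η : N, ((β η : ℤ) : ZMod p) * k - ∑ i, ((δ i η : ℤ) : ZMod p) * g i = 0) :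
    k = 0 ∧ ∀ i, g i = 0 := by
  haveI : Fact p.Prime := ⟨hp⟩
  have hk : k = 0 := by
    obtain ⟨η, hη⟩ := hnondiv
    rw [← ZMod.intCast_zmod_eq_zero_iff_dvd] at hη
    refine (mul_eq_zero.mp ?_).resolve_left hη
    have hA : ∀ i, ((Finset.univ.lcm a : ℕ) : ZMod p)
        = ((Finset.univ.lcm a / a i : ℕ) : ZMod p) * (a i : ZMod p) := by
      intro i
      rw [← Nat.cast_mul, Nat.div_mul_cancel (Finset.dvd_lcm (Finset.mem_univ i))]
    have h3 : ∑ i, (b i : ZMod p) * ((Finset.univ.lcm a / a i : ℕ) : ZMod p)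
          * ((δ i η : ℤ) : ZMod p) * k
        = - (((Finset.univ.lcm a : ℕ) : ZMod p) * ∑ i, ((δ i η : ℤ) : ZMod p) * g i) := by
      rw [Finset.mul_sum, ← Finset.sum_neg_distrib]
      refine Finset.sum_congr rfl fun i _ => ?_
      rw [hA i]
      linear_combination
        ((Finset.univ.lcm a / a i : ℕ) : ZMod p) * ((δ i η : ℤ) : ZMod p) * h1 i
    rw [Int.cast_add, Int.cast_sum, add_mul, Finset.sum_mul]
    simp only [Int.cast_mul, Int.cast_natCast]
    rw [h3]
    linear_combination ((Finset.univ.lcm a : ℕ) : ZMod p) * h2 η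
  refine ⟨hk, fun j => ?_⟩
  obtain ⟨e, he⟩ := hbasis
  have h := h2 (e j)
  simpa [hk, he] using h
end
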